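/- Let I be a nonempty subset of {1,…,n}. For every real ψ with 0 ≤ ψ ≤ √(H(I)), P( |C_I(σ) − H(I)| ≥ ψ·√(H(I)) ) ≤ 20·e^{−ψ²/3}. -/

import Mathlib

open Finset

/-- The number of cycles of length `j` in the permutation `σ` of `{1,…,n}`
(fixed points count as cycles of length 1): the number of points whose
orbit under `σ` has size `j`, divided by `j`. -/
noncomputable def cycleCount {n : ℕ} (σ : Equiv.Perm (Fin n)) (j : ℕ) : ℕ :=
  (Finset.univ.filter fun x => Function.minimalPeriod (⇑σ) x = j).card / j

/-- The number of cycles of `σ` whose length lies in the set `I`. -/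
noncomputable def cycleCountIn {n : ℕ} (σ : Equiv.Perm (Fin n)) (I : Finset ℕ) : ℕ :=
  ∑ j ∈ I, cycleCount σ j

/-- The total number of cycles of `σ` (fixed points included as 1-cycles). -/
noncomputable def totalCycles {n : ℕ} (σ : Equiv.Perm (Fin n)) : ℕ :=
  cycleCountIn σ (Finset.Icc 1 n)

/-- Probability of an event under a uniformly random permutation of `{1,…,n}`. -/
noncomputable def permP (n : ℕ) (E : Equiv.Perm (Fin n) → Prop) : ℝ :=
  (Nat.card {σ : Equiv.Perm (Fin n) // E σ} : ℝ) / n.factorial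

/-- Expectation of `f` under a uniformly random permutation of `{1,…,n}`. -/
noncomputable def permE (n : ℕ) (f : Equiv.Perm (Fin n) → ℝ) : ℝ :=
  (∑ σ : Equiv.Perm (Fin n), f σ) / n.factorial

/-- `H(I) = ∑_{j ∈ I} 1/j`. -/
noncomputable def Hset (I : Finset ℕ) : ℝ := ∑ j ∈ I, (1 : ℝ) / j

/-- The harmonic sum `H_n = ∑_{i=1}^n 1/i`. -/
noncomputable def harm (n : ℕ) : ℝ := Hset (Finset.Icc 1 n)


section Helpers

lemma minPer_eq {n : ℕ} (σ : Equiv.Perm (Fin n)) (x : Fin n) (hx : x ∈ σ.support) :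
    Function.minimalPeriod (⇑σ) x = (σ.cycleOf x).support.card := by
  have hon := Equiv.Perm.isCycleOn_support_cycleOf σ x
  have hxs : x ∈ (σ.cycleOf x).support :=
    Equiv.Perm.mem_support_cycleOf_iff.mpr ⟨Equiv.Perm.SameCycle.refl _ _, hx⟩
  apply Nat.dvd_antisymm
  · apply Function.IsPeriodicPt.minimalPeriod_dvd
    have h := (hon.pow_apply_eq hxs (n := (σ.cycleOf x).support.card)).mpr dvd_rfl
    rw [Function.IsPeriodicPt, Function.IsFixedPt, ← Equiv.Perm.coe_pow]
    exact h
  · rw [← hon.pow_apply_eq hxs]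
    have h := Function.isPeriodicPt_minimalPeriod (⇑σ) x
    rw [Function.IsPeriodicPt, Function.IsFixedPt, ← Equiv.Perm.coe_pow] at h
    exact h

lemma minPer_one {n : ℕ} (σ : Equiv.Perm (Fin n)) (x : Fin n) :
    Function.minimalPeriod (⇑σ) x = 1 ↔ x ∉ σ.support := by
  rw [Function.minimalPeriod_eq_one_iff_isFixedPt, Equiv.Perm.notMem_support]
  rfl

lemma card_minPer {n : ℕ} (σ : Equiv.Perm (Fin n)) (j : ℕ) (hj : 2 ≤ j) :
    (Finset.univ.filter fun x => Function.minimalPeriod (⇑σ) x = j).card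
      = σ.cycleType.count j * j := by
  have hc : σ.cycleType.count j = (σ.cycleFactorsFinset.filter (fun c => c.support.card = j)).card := by
    rw [Equiv.Perm.cycleType_def, Multiset.count_map, Finset.card_def, Finset.filter_val]
    congr 1
    apply Multiset.filter_congr
    intro c _
    simp [eq_comm]
  rw [hc]
  have hmem : ∀ x, Function.minimalPeriod (⇑σ) x = j → x ∈ σ.support := by
    intro x hx
    by_contra h
    rw [← minPer_one] at h
    omega
  rw [Finset.card_eq_sum_card_fiberwise (f := fun x => σ.cycleOf x)
    (t := σ.cycleFactorsFinset.filter (fun c => c.support.card = j))]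
  · rw [Finset.sum_const_nat]
    intro c hcm
    rw [Finset.mem_filter] at hcm
    conv_rhs => rw [← hcm.2]
    congr 1
    ext x
    simp only [Finset.mem_filter, Finset.mem_univ, true_and]
    constructor
    · rintro ⟨h1, h2⟩
      exact (Equiv.Perm.eq_cycleOf_of_mem_cycleFactorsFinset_iff σ c hcm.1 x).mp h2.symm
    · intro h
      have h2 := (Equiv.Perm.eq_cycleOf_of_mem_cycleFactorsFinset_iff σ c hcm.1 x).mpr h
      refine ⟨?_, h2.symm⟩
      rw [minPer_eq, ← h2, hcm.2]
      rw [← Equiv.Perm.cycleOf_mem_cycleFactorsFinset_iff, ← h2]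
      exact hcm.1
  · intro x hx
    simp only [Finset.coe_filter, Finset.mem_univ, true_and, Set.mem_ofPred_eq] at hx ⊢
    refine ⟨Equiv.Perm.cycleOf_mem_cycleFactorsFinset_iff.mpr (hmem x hx), ?_⟩
    rw [← minPer_eq σ x (hmem x hx), hx]

lemma cycleCount_two {n : ℕ} (σ : Equiv.Perm (Fin n)) (j : ℕ) (hj : 2 ≤ j) :
    cycleCount σ j = σ.cycleType.count j := by
  rw [cycleCount, card_minPer σ j hj, Nat.mul_div_cancel _ (by omega)]

lemma cycleCount_one {n : ℕ} (σ : Equiv.Perm (Fin n)) :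
    cycleCount σ 1 = n - σ.cycleType.sum := by
  rw [cycleCount, Nat.div_one, Equiv.Perm.sum_cycleType]
  simp only [minPer_one]
  have := Finset.card_compl σ.support
  rw [Fintype.card_fin] at this
  rw [← this]
  congr 1
  ext x
  simp

lemma cycleCount_weight {n : ℕ} (σ : Equiv.Perm (Fin n)) :
    ∑ i : Fin n, (i.val + 1) * cycleCount σ (i.val + 1) = n := by
  have h : ∀ j : ℕ, 1 ≤ j → j * cycleCount σ j =
      (Finset.univ.filter fun x => Function.minimalPeriod (⇑σ) x = j).card := by
    intro j hj
    rcases Nat.lt_or_ge j 2 with h | h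
    · obtain rfl : j = 1 := by omega
      simp [cycleCount]
    · rw [cycleCount_two σ j h, card_minPer σ j h, mul_comm]
  have hb : ∀ x, 1 ≤ Function.minimalPeriod (⇑σ) x ∧ Function.minimalPeriod (⇑σ) x ≤ n := by
    intro x
    by_cases hx : x ∈ σ.support
    · rw [minPer_eq σ x hx]
      constructor
      · apply Finset.card_pos.mpr
        exact ⟨x, Equiv.Perm.mem_support_cycleOf_iff.mpr ⟨Equiv.Perm.SameCycle.refl _ _, hx⟩⟩
      · exact (Finset.card_le_univ _).trans (by simp)
    · rw [(minPer_one σ x).mpr hx]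
      exact ⟨le_rfl, by have := x.2; omega⟩
  have key := Finset.card_eq_sum_card_fiberwise (s := (Finset.univ : Finset (Fin n)))
    (t := (Finset.univ : Finset (Fin n)))
    (f := fun x => (⟨Function.minimalPeriod (⇑σ) x - 1, by have := hb x; omega⟩ : Fin n))
    (by intro x _; simp)
  rw [Finset.card_univ, Fintype.card_fin] at key
  conv_rhs => rw [key]
  apply Finset.sum_congr rfl
  intro i _
  rw [h _ (by omega)]
  congr 1
  ext x
  have := hb x
  simp only [Finset.mem_filter, Finset.mem_univ, true_and, Fin.ext_iff]
  omega

lemma prod_Fin_shift {n : ℕ} (f : ℕ → ℕ) :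
    ∏ i : Fin n, f (i.val + 1) = ∏ j ∈ Finset.Icc 1 n, f j := by
  rw [Fin.prod_univ_eq_prod_range (fun i => f (i + 1)) n, Finset.range_eq_Ico,
    Finset.prod_Ico_add' f 0 n 1]
  rfl

lemma fiber_card {n : ℕ} (hn : 1 ≤ n) (σ₀ : Equiv.Perm (Fin n)) :
    (Finset.univ.filter fun σ : Equiv.Perm (Fin n) =>
      (fun i : Fin n => cycleCount σ (i.val + 1)) = fun i : Fin n => cycleCount σ₀ (i.val + 1)).card
      * ∏ i : Fin n, ((i.val + 1) ^ cycleCount σ₀ (i.val + 1) * (cycleCount σ₀ (i.val + 1)).factorial)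
      ≤ n.factorial := by
  set m := σ₀.cycleType with hm
  have hm2 : ∀ a ∈ m, 2 ≤ a := fun a ha => Equiv.Perm.two_le_of_mem_cycleType ha
  have hmn : ∀ (σ : Equiv.Perm (Fin n)), ∀ a ∈ σ.cycleType, a ≤ n := fun σ a ha =>
    (Equiv.Perm.le_card_support_of_mem_cycleType ha).trans ((Finset.card_le_univ _).trans (by simp))
  have hsub : (Finset.univ.filter fun σ : Equiv.Perm (Fin n) =>
      (fun i : Fin n => cycleCount σ (i.val + 1)) = fun i : Fin n => cycleCount σ₀ (i.val + 1)) ⊆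
      Finset.univ.filter fun σ : Equiv.Perm (Fin n) => σ.cycleType = m := by
    intro σ hσ
    simp only [Finset.mem_filter, Finset.mem_univ, true_and] at hσ ⊢
    ext j
    rcases Nat.lt_or_ge j 2 with h | h
    · rw [Multiset.count_eq_zero_of_notMem, Multiset.count_eq_zero_of_notMem]
      · intro hj; have := hm2 j hj; omega
      · intro hj; have := Equiv.Perm.two_le_of_mem_cycleType hj; omega
    · rcases Nat.lt_or_ge n j with h' | h'
      · rw [Multiset.count_eq_zero_of_notMem, Multiset.count_eq_zero_of_notMem]
        · intro hj; have := hmn _ j hj; omega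
        · intro hj; have := hmn _ j hj; omega
      · have := congrFun hσ ⟨j - 1, by omega⟩
        simp only [Nat.sub_add_cancel (show 1 ≤ j by omega)] at this
        rwa [cycleCount_two _ _ h, cycleCount_two _ _ h] at this
  have hcard := Equiv.Perm.card_of_cycleType_mul_eq (Fin n) m
  rw [if_pos ⟨Equiv.Perm.sum_cycleType_le _, hm2⟩, Fintype.card_fin] at hcard
  have hprod : ∏ i : Fin n, ((i.val + 1) ^ cycleCount σ₀ (i.val + 1)
      * (cycleCount σ₀ (i.val + 1)).factorial)
      = (n - m.sum).factorial * m.prod * ∏ a ∈ m.toFinset, (m.count a).factorial := by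
    rw [prod_Fin_shift (fun j => j ^ cycleCount σ₀ j * (cycleCount σ₀ j).factorial)]
    have hI : Finset.Icc 1 n = insert 1 (Finset.Icc 2 n) := by
      ext j; simp only [Finset.mem_Icc, Finset.mem_insert]; omega
    rw [hI, Finset.prod_insert (by simp), cycleCount_one, one_pow, one_mul, mul_assoc,
      Finset.prod_multiset_count m, ← Finset.prod_mul_distrib]
    congr 1
    symm
    rw [← Finset.prod_subset (s₁ := m.toFinset) (s₂ := Finset.Icc 2 n)]
    · apply Finset.prod_congr rfl
      intro j hj
      rw [cycleCount_two _ _ (hm2 j (Multiset.mem_toFinset.mp hj))]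
    · intro j hj
      rw [Multiset.mem_toFinset] at hj
      exact Finset.mem_Icc.mpr ⟨hm2 j hj, hmn _ j hj⟩
    · intro j hj hj'
      rw [Multiset.mem_toFinset] at hj'
      rw [cycleCount_two _ _ (Finset.mem_Icc.mp hj).1, ← hm, Multiset.count_eq_zero_of_notMem hj']
      simp
  rw [hprod, ← hcard]
  exact Nat.mul_le_mul_right _ (Finset.card_le_card hsub)

/-- Weight of a cycle-count vector. -/
noncomputable def wgt {n : ℕ} (b : Fin n → ℝ) (m : Fin n → ℕ) : ℝ :=
  ∏ i, (b i ^ m i / (m i).factorial)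

lemma wgt_nonneg {n : ℕ} (b : Fin n → ℝ) (hb : ∀ i, 0 ≤ b i) (m : Fin n → ℕ) : 0 ≤ wgt b m :=
  Finset.prod_nonneg fun i _ => div_nonneg (pow_nonneg (hb i) _) (by positivity)

lemma wgt_dec {n : ℕ} (b : Fin n → ℝ) (m : Fin n → ℕ) (i : Fin n) (hi : 1 ≤ m i) :
    (m i : ℝ) * wgt b m = b i * wgt b (Function.update m i (m i - 1)) := by
  unfold wgt
  rw [← Finset.mul_prod_erase _ _ (Finset.mem_univ i),
    ← Finset.mul_prod_erase _ (fun j => b j ^ (Function.update m i (m i - 1)) j /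
      ((Function.update m i (m i - 1)) j).factorial) (Finset.mem_univ i)]
  have : ∏ j ∈ Finset.univ.erase i, b j ^ (Function.update m i (m i - 1)) j /
      (((Function.update m i (m i - 1)) j).factorial : ℝ) =
      ∏ j ∈ Finset.univ.erase i, b j ^ m j / ((m j).factorial : ℝ) := by
    apply Finset.prod_congr rfl
    intro j hj
    rw [Function.update_of_ne (Finset.ne_of_mem_erase hj)]
  rw [this, ← mul_assoc, ← mul_assoc]
  congr 1
  simp only [Function.update_self]
  obtain ⟨k, hk⟩ : ∃ k, m i = k + 1 := ⟨m i - 1, by omega⟩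
  rw [hk, Nat.add_sub_cancel, Nat.factorial_succ, pow_succ]
  have : ((k.factorial : ℕ) : ℝ) ≠ 0 := by positivity
  have : ((k : ℝ) + 1) ≠ 0 := by positivity
  push_cast
  field_simp

lemma sum_wgt_le {n : ℕ} (b : Fin n → ℝ) (hb : ∀ i, 0 ≤ b i) (B : ℝ) (hB : 0 ≤ B)
    (hbB : ∀ i : Fin n, ((i.val : ℝ) + 1) * b i ≤ B) (S : Finset (Fin n → ℕ))
    (hS : ∀ m ∈ S, ∑ i : Fin n, (i.val + 1) * m i = n) :
    n * ∑ m ∈ S, wgt b m ≤ B * Real.exp (∑ i, b i) := by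
  have hle : ∀ m ∈ S, ∀ i, m i ≤ n := by
    intro m hm i
    have h := Finset.single_le_sum (f := fun i : Fin n => (i.val + 1) * m i)
      (fun _ _ => Nat.zero_le _) (Finset.mem_univ i)
    rw [hS m hm] at h
    have : m i ≤ (i.val + 1) * m i := Nat.le_mul_of_pos_left _ (by omega)
    exact this.trans h
  set T := ((Finset.univ : Finset (Fin n)) ×ˢ S).filter (fun p => 1 ≤ p.2 p.1) with hT
  set g : Fin n × (Fin n → ℕ) → (Fin n → ℕ) :=
    fun p => Function.update p.2 p.1 (p.2 p.1 - 1) with hg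
  have hgw : ∀ p ∈ T, ∑ i : Fin n, (i.val + 1) * g p i + (p.1.val + 1) = n := by
    intro p hp
    simp only [hT, Finset.mem_filter, Finset.mem_product, Finset.mem_univ, true_and] at hp
    conv_rhs => rw [← hS p.2 hp.1]
    rw [← Finset.add_sum_erase _ _ (Finset.mem_univ p.1),
      ← Finset.add_sum_erase _ (fun i : Fin n => (i.val + 1) * p.2 i) (Finset.mem_univ p.1)]
    have : ∑ j ∈ Finset.univ.erase p.1, (j.val + 1) * g p j =
        ∑ j ∈ Finset.univ.erase p.1, (j.val + 1) * p.2 j := by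
      apply Finset.sum_congr rfl
      intro j hj
      simp only [hg]
      rw [Function.update_of_ne (Finset.ne_of_mem_erase hj)]
    rw [this]
    simp only [hg, Function.update_self]
    obtain ⟨k, hk⟩ : ∃ k, p.2 p.1 = k + 1 := ⟨p.2 p.1 - 1, by omega⟩
    rw [hk, Nat.add_sub_cancel]
    ring
  have hinj : Set.InjOn g (T : Set (Fin n × (Fin n → ℕ))) := by
    intro p hp q hq hpq
    have h1 := hgw p hp
    have h2 := hgw q hq
    rw [hpq] at h1
    have h3 : p.1 = q.1 := Fin.ext (by omega)
    have hp' := (Finset.mem_filter.mp hp).2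
    have hq' := (Finset.mem_filter.mp hq).2
    refine Prod.ext h3 (funext fun j => ?_)
    have h4 := congrFun hpq j
    simp only [hg] at h4
    by_cases hj : j = p.1
    · have hj2 : j = q.1 := hj.trans h3
      rw [← hj] at h4 hp'
      rw [← hj2] at h4 hq'
      simp only [Function.update_self] at h4
      omega
    · have hj2 : j ≠ q.1 := h3 ▸ hj
      rwa [Function.update_of_ne hj, Function.update_of_ne hj2] at h4
  calc (n : ℝ) * ∑ m ∈ S, wgt b m
      = ∑ m ∈ S, ∑ i : Fin n, ((i.val : ℝ) + 1) * (m i * wgt b m) := by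
        rw [Finset.mul_sum]
        apply Finset.sum_congr rfl
        intro m hm
        have h : (n : ℝ) = ∑ i : Fin n, ((i.val : ℝ) + 1) * m i := by
          have := hS m hm
          exact_mod_cast this.symm
        conv_lhs => rw [h, Finset.sum_mul]
        apply Finset.sum_congr rfl
        intros; ring
    _ = ∑ p ∈ (Finset.univ : Finset (Fin n)) ×ˢ S,
          ((p.1.val : ℝ) + 1) * (p.2 p.1 * wgt b p.2) := by
        rw [Finset.sum_product_right]
    _ = ∑ p ∈ T, ((p.1.val : ℝ) + 1) * (p.2 p.1 * wgt b p.2) := by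
        symm
        apply Finset.sum_subset (Finset.filter_subset _ _)
        intro p hp hp'
        have : p.2 p.1 = 0 := by
          by_contra h
          exact hp' (Finset.mem_filter.mpr ⟨hp, by omega⟩)
        rw [this]; simp
    _ ≤ ∑ p ∈ T, B * wgt b (g p) := by
        apply Finset.sum_le_sum
        intro p hp
        rw [wgt_dec b p.2 p.1 (Finset.mem_filter.mp hp).2, ← mul_assoc]
        exact mul_le_mul_of_nonneg_right (hbB _) (wgt_nonneg b hb _)
    _ = B * ∑ m ∈ T.image g, wgt b m := by
        rw [Finset.sum_image hinj, Finset.mul_sum]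
    _ ≤ B * ∑ m ∈ Fintype.piFinset (fun _ : Fin n => Finset.range (n + 1)), wgt b m := by
        apply mul_le_mul_of_nonneg_left _ hB
        apply Finset.sum_le_sum_of_subset_of_nonneg
        · intro m hm
          obtain ⟨p, hp, rfl⟩ := Finset.mem_image.mp hm
          rw [Fintype.mem_piFinset]
          intro j
          have h := hle p.2 (Finset.mem_product.mp (Finset.mem_filter.mp hp).1).2
          rw [Finset.mem_range]
          simp only [hg]
          by_cases hj : j = p.1
          · subst hj
            have := h p.1
            simp only [Function.update_self]; omega
          · rw [Function.update_of_ne hj]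
            have := h j
            omega
        · intros; exact wgt_nonneg b hb _
    _ = B * ∏ i, ∑ k ∈ Finset.range (n + 1), b i ^ k / (k.factorial : ℝ) := by
        rw [Finset.prod_univ_sum]
        rfl
    _ ≤ B * Real.exp (∑ i, b i) := by
        apply mul_le_mul_of_nonneg_left _ hB
        rw [Real.exp_sum]
        apply Finset.prod_le_prod
        · intro i _
          exact Finset.sum_nonneg fun k _ => div_nonneg (pow_nonneg (hb i) _) (by positivity)
        · intro i _
          exact Real.sum_le_exp_of_nonneg (hb i) _

lemma sum_Fin_shift {n : ℕ} (f : ℕ → ℝ) :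
    ∑ i : Fin n, f (i.val + 1) = ∑ j ∈ Finset.Icc 1 n, f j := by
  rw [Fin.sum_univ_eq_sum_range (fun i => f (i + 1)) n, Finset.range_eq_Ico,
    Finset.sum_Ico_add' f 0 n 1]
  rfl

lemma prod_Fin_shift_real {n : ℕ} (f : ℕ → ℝ) :
    ∏ i : Fin n, f (i.val + 1) = ∏ j ∈ Finset.Icc 1 n, f j := by
  rw [Fin.prod_univ_eq_prod_range (fun i => f (i + 1)) n, Finset.range_eq_Ico,
    Finset.prod_Ico_add' f 0 n 1]
  rfl

lemma mgf_bound (n : ℕ) (hn : 1 ≤ n) (I : Finset ℕ) (hsub : I ⊆ Finset.Icc 1 n) (z : ℝ)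
    (hz : 0 ≤ z) (hz2 : z ≤ 2) :
    ∑ σ : Equiv.Perm (Fin n), z ^ cycleCountIn σ I ≤
      n.factorial * (2 * Real.exp 1 * Real.exp ((z - 1) * Hset I)) := by
  classical
  set a : ℕ → ℝ := fun j => if j ∈ I then z else 1 with ha
  have ha0 : ∀ j, 0 ≤ a j := by intro j; simp only [ha]; split_ifs <;> linarith
  have ha2 : ∀ j, a j ≤ 2 := by intro j; simp only [ha]; split_ifs <;> linarith
  set b : Fin n → ℝ := fun i => a (i.val + 1) / ((i.val + 1 : ℕ) : ℝ) with hb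
  have hb0 : ∀ i, 0 ≤ b i := fun i => div_nonneg (ha0 _) (by positivity)
  set c : Equiv.Perm (Fin n) → Fin n → ℕ := fun σ i => cycleCount σ (i.val + 1) with hc
  have hpow : ∀ σ : Equiv.Perm (Fin n), z ^ cycleCountIn σ I = ∏ i, a (i.val + 1) ^ c σ i := by
    intro σ
    rw [prod_Fin_shift_real (fun j => a j ^ cycleCount σ j), cycleCountIn, ← Finset.prod_pow_eq_pow_sum,
      ← Finset.prod_subset hsub]
    · apply Finset.prod_congr rfl
      intro j hj
      simp [ha, hj]
    · intro j _ hj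
      simp [ha, hj]
  have h1 : ∑ σ : Equiv.Perm (Fin n), z ^ cycleCountIn σ I ≤
      n.factorial * ∑ m ∈ Finset.univ.image c, wgt b m := by
    rw [← Finset.sum_fiberwise_of_maps_to (s := Finset.univ) (t := Finset.univ.image c) (g := c)
      (fun σ _ => Finset.mem_image_of_mem c (Finset.mem_univ σ)), Finset.mul_sum]
    apply Finset.sum_le_sum
    intro m hm
    obtain ⟨σ₀, _, rfl⟩ := Finset.mem_image.mp hm
    have hconst : ∑ σ ∈ Finset.univ.filter (fun σ => c σ = c σ₀), z ^ cycleCountIn σ I =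
        ((Finset.univ.filter (fun σ => c σ = c σ₀)).card : ℝ) * ∏ i, a (i.val + 1) ^ c σ₀ i := by
      rw [← nsmul_eq_mul, ← Finset.sum_const]
      apply Finset.sum_congr rfl
      intro σ hσ
      rw [hpow, (Finset.mem_filter.mp hσ).2]
    rw [hconst]
    have hf := fiber_card hn σ₀
    have hf' : ((Finset.univ.filter (fun σ => c σ = c σ₀)).card : ℝ) *
        ∏ i : Fin n, (((i.val + 1 : ℕ) : ℝ) ^ c σ₀ i * ((c σ₀ i).factorial : ℝ)) ≤ n.factorial := by
      exact_mod_cast hf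
    have hw : wgt b (c σ₀) * ∏ i : Fin n, (((i.val + 1 : ℕ) : ℝ) ^ c σ₀ i * ((c σ₀ i).factorial : ℝ))
        = ∏ i, a (i.val + 1) ^ c σ₀ i := by
      rw [wgt, ← Finset.prod_mul_distrib]
      apply Finset.prod_congr rfl
      intro i _
      simp only [hb]
      have : ((i.val + 1 : ℕ) : ℝ) ≠ 0 := by positivity
      have : ((c σ₀ i).factorial : ℝ) ≠ 0 := by positivity
      rw [div_pow]
      field_simp
    rw [← hw]
    calc _ = (((Finset.univ.filter (fun σ => c σ = c σ₀)).card : ℝ) *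
        ∏ i : Fin n, (((i.val + 1 : ℕ) : ℝ) ^ c σ₀ i * ((c σ₀ i).factorial : ℝ))) * wgt b (c σ₀) := by
          ring
      _ ≤ _ := mul_le_mul_of_nonneg_right hf' (wgt_nonneg b hb0 _)
  have h2 := sum_wgt_le b hb0 2 (by norm_num) (by
    intro i
    simp only [hb]
    have : ((i.val : ℝ) + 1) ≠ 0 := by positivity
    push_cast
    rw [mul_div_cancel₀ _ this]
    exact ha2 _) (Finset.univ.image c) (by
    intro m hm
    obtain ⟨σ₀, _, rfl⟩ := Finset.mem_image.mp hm
    exact cycleCount_weight σ₀)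
  have hn0 : (0 : ℝ) < n := by exact_mod_cast hn
  have hsum : ∑ i, b i ≤ 1 + Real.log n + (z - 1) * Hset I := by
    have e1 : ∑ i, b i = ∑ j ∈ Finset.Icc 1 n, (1 / (j : ℝ) + if j ∈ I then (z - 1) * (1 / (j : ℝ)) else 0) := by
      simp only [hb]
      rw [sum_Fin_shift (fun j => a j / (j : ℝ))]
      apply Finset.sum_congr rfl
      intro j _
      simp only [ha]
      split_ifs <;> ring
    rw [e1, Finset.sum_add_distrib, ← Finset.sum_filter, Finset.filter_mem_eq_inter,
      Finset.inter_eq_right.mpr hsub, ← Finset.mul_sum]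
    have e2 := harmonic_le_one_add_log n
    rw [harmonic_eq_sum_Icc] at e2
    push_cast at e2
    simp only [Hset, one_div] at e2 ⊢
    linarith
  have h3 : n * ∑ m ∈ Finset.univ.image c, wgt b m ≤
      n * (2 * Real.exp 1 * Real.exp ((z - 1) * Hset I)) := by
    refine h2.trans ?_
    calc 2 * Real.exp (∑ i, b i) ≤ 2 * Real.exp (1 + Real.log n + (z - 1) * Hset I) := by gcongr
      _ = _ := by rw [Real.exp_add, Real.exp_add, Real.exp_log hn0]; ring
  have h4 := le_of_mul_le_mul_left h3 hn0
  exact h1.trans (mul_le_mul_of_nonneg_left h4 (by positivity))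

lemma exp_quad (t : ℝ) (ht : |t| ≤ 2 / 3) : Real.exp t ≤ 1 + t + 3 / 4 * t ^ 2 := by
  have h := Real.exp_bound (x := t) (by linarith) (n := 3) (by norm_num)
  have h' := (abs_le.mp h).2
  simp [Finset.sum_range_succ, Nat.factorial] at h'
  have h3 : |t| ^ 3 ≤ 2 / 3 * t ^ 2 := by
    have : |t| ^ 3 = |t| * t ^ 2 := by rw [pow_succ, sq_abs]; ring
    rw [this]
    exact mul_le_mul_of_nonneg_right ht (sq_nonneg _)
  nlinarith [sq_nonneg t]

/-- One-sided tail bound, in both directions at once via the sign of `t`. -/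
lemma one_side (n : ℕ) (hn : 1 ≤ n) (I : Finset ℕ) (hsub : I ⊆ Finset.Icc 1 n) (t u : ℝ)
    (ht : |t| ≤ 2 / 3) (S : Finset (Equiv.Perm (Fin n)))
    (hS : ∀ σ ∈ S, u ≤ t * ((cycleCountIn σ I : ℝ) - Hset I)) :
    (S.card : ℝ) ≤ n.factorial * (2 * Real.exp 1 * Real.exp (3 / 4 * t ^ 2 * Hset I - u)) := by
  have hH : 0 ≤ Hset I := Finset.sum_nonneg fun j _ => by positivity
  have hq := exp_quad t ht
  have ht' := abs_le.mp ht
  have hm := mgf_bound n hn I hsub (Real.exp t) (Real.exp_pos _).le (by nlinarith)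
  have hS' : (S.card : ℝ) ≤ ∑ σ : Equiv.Perm (Fin n),
      Real.exp (- u - t * Hset I) * Real.exp t ^ cycleCountIn σ I := by
    calc (S.card : ℝ) = ∑ σ ∈ S, (1 : ℝ) := by simp
      _ ≤ ∑ σ ∈ S, Real.exp (- u - t * Hset I) * Real.exp t ^ cycleCountIn σ I := by
        apply Finset.sum_le_sum
        intro σ hσ
        rw [← Real.exp_nat_mul, ← Real.exp_add]
        apply Real.one_le_exp
        have := hS σ hσ
        linarith
      _ ≤ _ := Finset.sum_le_sum_of_subset_of_nonneg (Finset.subset_univ _)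
        (fun _ _ _ => by positivity)
  rw [← Finset.mul_sum] at hS'
  refine hS'.trans ((mul_le_mul_of_nonneg_left hm (Real.exp_pos _).le).trans ?_)
  calc _ = n.factorial * (2 * Real.exp 1 *
        (Real.exp (- u - t * Hset I) * Real.exp ((Real.exp t - 1) * Hset I))) := by ring
    _ ≤ _ := by
      rw [← Real.exp_add]
      gcongr
      nlinarith

end Helpers

/-- **Two-sided tail bound.** For nonempty `I ⊆ [n]` and `0 ≤ ψ ≤ √H(I)`,
`P(|C_I(σ) - H(I)| ≥ ψ √H(I)) ≤ 20 e^{-ψ²/3}`. -/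
theorem two_sided_tail_bound (n : ℕ) (I : Finset ℕ) (hne : I.Nonempty)
    (hsub : I ⊆ Finset.Icc 1 n) (psi : ℝ) (h0 : 0 ≤ psi)
    (h1 : psi ≤ Real.sqrt (Hset I)) :
    permP n (fun σ => psi * Real.sqrt (Hset I) ≤ |(cycleCountIn σ I : ℝ) - Hset I|)
      ≤ 20 * Real.exp (-psi ^ 2 / 3) := by
  classical
  obtain ⟨j, hj⟩ := hne
  have hjn := Finset.mem_Icc.mp (hsub hj)
  have hn : 1 ≤ n := hjn.1.trans hjn.2
  have hH : 0 < Hset I := by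
    apply Finset.sum_pos
    · intro i hi
      have : (0 : ℝ) < i := by exact_mod_cast (Finset.mem_Icc.mp (hsub hi)).1
      positivity
    · exact ⟨j, hj⟩
  set s := Real.sqrt (Hset I) with hs
  have hs0 : 0 < s := Real.sqrt_pos.mpr hH
  have hss : s ^ 2 = Hset I := Real.sq_sqrt hH.le
  set d := psi / s with hd
  have hd0 : 0 ≤ d := by positivity
  have hd1 : d ≤ 1 := (div_le_one hs0).mpr h1
  have hpsi : psi = d * s := by rw [hd]; field_simp
  have hE : -psi ^ 2 / 3 = 3 / 4 * (2 / 3 * d) ^ 2 * Hset I - 2 / 3 * d * (psi * s) := by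
    rw [← hss, hpsi]; ring
  have hE' : -psi ^ 2 / 3 = 3 / 4 * (-(2 / 3 * d)) ^ 2 * Hset I - 2 / 3 * d * (psi * s) := by
    rw [← hss, hpsi]; ring
  have habs : |2 / 3 * d| ≤ 2 / 3 := by rw [abs_of_nonneg (by positivity)]; linarith
  have hU := one_side n hn I hsub (2 / 3 * d) (2 / 3 * d * (psi * s)) habs
    (Finset.univ.filter fun σ => psi * s ≤ (cycleCountIn σ I : ℝ) - Hset I) (by
      intro σ hσ
      exact mul_le_mul_of_nonneg_left (Finset.mem_filter.mp hσ).2 (by positivity))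
  have hL := one_side n hn I hsub (-(2 / 3 * d)) (2 / 3 * d * (psi * s)) (by rwa [abs_neg])
    (Finset.univ.filter fun σ => psi * s ≤ -((cycleCountIn σ I : ℝ) - Hset I)) (by
      intro σ hσ
      rw [neg_mul, ← mul_neg]
      exact mul_le_mul_of_nonneg_left (Finset.mem_filter.mp hσ).2 (by positivity))
  rw [← hE] at hU
  rw [← hE'] at hL
  have hcard : Nat.card {σ : Equiv.Perm (Fin n) // psi * s ≤ |(cycleCountIn σ I : ℝ) - Hset I|} ≤
      (Finset.univ.filter fun σ : Equiv.Perm (Fin n) =>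
        psi * s ≤ (cycleCountIn σ I : ℝ) - Hset I).card +
      (Finset.univ.filter fun σ : Equiv.Perm (Fin n) =>
        psi * s ≤ -((cycleCountIn σ I : ℝ) - Hset I)).card := by
    rw [Nat.card_eq_fintype_card, Fintype.card_subtype]
    refine (Finset.card_le_card ?_).trans (Finset.card_union_le _ _)
    intro σ hσ
    simpa [le_abs] using hσ
  have hcard' := (Nat.cast_le (α := ℝ)).mpr hcard
  have hfac : (0 : ℝ) < n.factorial := by positivity
  unfold permP
  rw [div_le_iff₀ hfac]
  push_cast at hcard'
  have he : Real.exp 1 ≤ 3 := by have := Real.exp_one_lt_d9; linarith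
  have hpos : 0 ≤ Real.exp (-psi ^ 2 / 3) * n.factorial := by positivity
  nlinarith
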